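/- Let s ∈ ℝ with s ≠ 0 and define U : ℝ → ℝ by U(u) = s²u⁴/2 + (1/9)s²(4s² − 3)u⁶ + (1/6)s⁴(8s² − 5)u⁸ + (4/135)s⁴(224s⁴ − 138s² + 9)u¹⁰ + (2/243)s⁶(5440s⁴ − 3504s² + 423)u¹². Then u = 0 is a strict local minimum of U, and the equilibrium u = 0 of the one-dimensional gradient system u' = −U'(u) is locally asymptotically stable: it is Lyapunov stable, and there exists δ > 0 such that every differentiable curve γ : [0,∞) → ℝ with γ'(t) = −U'(γ(t)) for all t and |γ(0)| < δ satisfies γ(t) → 0 as t → ∞. -/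

import Mathlib

open Real Filter

noncomputable section

/-- Lyapunov stability of the equilibrium `p` of the vector field `X` on the domain `D`. -/
def LyapunovStable {E : Type*} [NormedAddCommGroup E] [NormedSpace ℝ E]
    (X : E → E) (D : Set E) (p : E) : Prop :=
  ∀ ε > 0, ∃ δ > 0, ∀ γ : ℝ → E,
    (∀ t : ℝ, 0 ≤ t → γ t ∈ D) →
    (∀ t : ℝ, 0 ≤ t → HasDerivAt γ (X (γ t)) t) →
    ‖γ 0 - p‖ < δ → ∀ t : ℝ, 0 ≤ t → ‖γ t - p‖ < ε

/-- Local asymptotic stability of the equilibrium `p` of the vector field `X` on `D`: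
Lyapunov stability together with local attractivity. -/
def LocallyAsympStable {E : Type*} [NormedAddCommGroup E] [NormedSpace ℝ E]
    (X : E → E) (D : Set E) (p : E) : Prop :=
  LyapunovStable X D p ∧
    ∃ δ > 0, ∀ γ : ℝ → E,
      (∀ t : ℝ, 0 ≤ t → γ t ∈ D) →
      (∀ t : ℝ, 0 ≤ t → HasDerivAt γ (X (γ t)) t) →
      ‖γ 0 - p‖ < δ → Filter.Tendsto γ Filter.atTop (nhds p)

/-- The potential of the gradient-like equation on the center manifold of the de Sitter
point P₂₆ of HL cosmology beyond detailed balance with exponential potential. -/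
def U19 (s u : ℝ) : ℝ :=
  s ^ 2 * u ^ 4 / 2 + (1 / 9) * s ^ 2 * (4 * s ^ 2 - 3) * u ^ 6
    + (1 / 6) * s ^ 4 * (8 * s ^ 2 - 5) * u ^ 8
    + (4 / 135) * s ^ 4 * (224 * s ^ 4 - 138 * s ^ 2 + 9) * u ^ 10
    + (2 / 243) * s ^ 6 * (5440 * s ^ 4 - 3504 * s ^ 2 + 423) * u ^ 12

/-- A solution of `γ' = -γ³ q(γ)` with `q ≥ k > 0` near the origin satisfies an explicit algebraic
decay estimate. -/
theorem sq_le_of_hasDerivAt_neg_cube_mul {q γ : ℝ → ℝ} {k r c : ℝ} (hk : 0 < k)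
    (hq : ∀ u, u ^ 2 < r ^ 2 → k ≤ q u)
    (hγ : ∀ t : ℝ, 0 ≤ t → HasDerivAt γ (-(γ t ^ 3 * q (γ t))) t)
    (hc : 0 < c) (hcr : c < r ^ 2) (h0 : γ 0 ^ 2 ≤ c) {t : ℝ} (ht : 0 ≤ t) :
    γ t ^ 2 ≤ c / (1 + k * c * t) := by
  have hpos : ∀ x : ℝ, 0 ≤ x → 0 < 1 + k * c * x := fun x hx => by positivity
  have hsq : ∀ x : ℝ, 0 ≤ x →
      HasDerivAt (fun x => γ x ^ 2) (-(2 * γ x ^ 4 * q (γ x))) x := fun x hx =>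
    ((hγ x hx).pow 2).congr_deriv (by push_cast; ring)
  have hB : ∀ x : ℝ, 0 ≤ x → HasDerivAt (fun x => c / (1 + k * c * x))
      (-(k * (c / (1 + k * c * x)) ^ 2)) x := fun x hx => by
    have hden : HasDerivAt (fun x => 1 + k * c * x) (k * c) x := by
      simpa using ((hasDerivAt_id x).const_mul (k * c)).const_add 1
    refine ((hasDerivAt_const x c).div hden (hpos x hx).ne').congr_deriv ?_
    have := (hpos x hx).ne'
    field_simp
    ring
  refine image_le_of_deriv_right_lt_deriv_boundary' (f := fun x => γ x ^ 2)
    (f' := fun x => -(2 * γ x ^ 4 * q (γ x))) (a := 0) (b := t)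
    (B := fun x => c / (1 + k * c * x)) (B' := fun x => -(k * (c / (1 + k * c * x)) ^ 2))
    (fun x hx => (hsq x hx.1).continuousAt.continuousWithinAt)
    (fun x hx => (hsq x hx.1).hasDerivWithinAt) (by simpa using h0)
    (fun x hx => (hB x hx.1).continuousAt.continuousWithinAt)
    (fun x hx => (hB x hx.1).hasDerivWithinAt) ?_ (Set.right_mem_Icc.2 ht)
  intro x hx hxB
  have hBpos : 0 < c / (1 + k * c * x) := div_pos hc (hpos x hx.1)
  have hBc : c / (1 + k * c * x) ≤ c :=
    div_le_self hc.le (le_add_of_nonneg_right (by have := hx.1; positivity))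
  have hkq := hq (γ x) (by rw [hxB]; exact hBc.trans_lt hcr)
  rw [← hxB] at hBpos ⊢
  have h4 : 0 < γ x ^ 4 := by nlinarith [pow_pos hBpos 2]
  nlinarith [mul_le_mul_of_nonneg_left hkq h4.le, mul_pos hk h4]

/-- The origin is locally asymptotically stable for `u' = -u³ q(u)` if `q` is continuous and
positive at the origin. -/
theorem locallyAsympStable_neg_cube_mul {q : ℝ → ℝ} (hq : ContinuousAt q 0) (hq0 : 0 < q 0) :
    LocallyAsympStable (fun u => -(u ^ 3 * q u)) (Set.univ : Set ℝ) 0 := by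
  obtain ⟨r, hr, hqr⟩ := Metric.eventually_nhds_iff.1
    (hq.eventually (lt_mem_nhds (half_lt_self hq0)))
  have hk : 0 < q 0 / 2 := half_pos hq0
  have hkq : ∀ u, u ^ 2 < r ^ 2 → q 0 / 2 ≤ q u := fun u hu =>
    (hqr (by simpa [Real.dist_eq] using abs_lt_of_sq_lt_sq hu hr.le)).le
  have hmid : ∀ {δ x : ℝ}, |x| < δ → ∃ c, 0 < c ∧ x ^ 2 ≤ c ∧ c < δ ^ 2 := fun {δ x} hx => by
    have hlt : x ^ 2 < δ ^ 2 := sq_lt_sq' (neg_lt_of_abs_lt hx) (lt_of_abs_lt hx)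
    exact ⟨(x ^ 2 + δ ^ 2) / 2, by nlinarith [sq_nonneg x], by linarith, by linarith⟩
  refine ⟨fun ε hε => ⟨min ε r, lt_min hε hr, fun γ _ hγ h0 t ht => ?_⟩,
    r, hr, fun γ _ hγ h0 => ?_⟩
  · rw [sub_zero, Real.norm_eq_abs] at h0 ⊢
    obtain ⟨c, hc, h0c, hcδ⟩ := hmid h0
    have hδ : 0 < min ε r := lt_min hε hr
    have hδr : min ε r ^ 2 ≤ r ^ 2 := pow_le_pow_left₀ hδ.le (min_le_right _ _) 2
    have hle := sq_le_of_hasDerivAt_neg_cube_mul hk hkq hγ hc (hcδ.trans_le hδr) h0c ht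
    have hBc : c / (1 + q 0 / 2 * c * t) ≤ c :=
      div_le_self hc.le (le_add_of_nonneg_right (by positivity))
    exact (abs_lt_of_sq_lt_sq (hle.trans_lt (hBc.trans_lt hcδ)) hδ.le).trans_le (min_le_left _ _)
  · rw [sub_zero, Real.norm_eq_abs] at h0
    obtain ⟨c, hc, h0c, hcr⟩ := hmid h0
    have hB : Tendsto (fun t => c / (1 + q 0 / 2 * c * t)) atTop (nhds 0) :=
      tendsto_const_nhds.div_atTop
        (tendsto_atTop_add_const_left _ _ (tendsto_id.const_mul_atTop (mul_pos hk hc)))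
    have hsq : Tendsto (fun t => γ t ^ 2) atTop (nhds 0) :=
      squeeze_zero' (Eventually.of_forall fun t => sq_nonneg _)
        ((eventually_ge_atTop 0).mono fun t ht =>
          sq_le_of_hasDerivAt_neg_cube_mul hk hkq hγ hc hcr h0c ht) hB
    exact (tendsto_zero_iff_abs_tendsto_zero γ).2
      (by simpa [Function.comp_def, Real.sqrt_sq_eq_abs] using hsq.sqrt)

/-- The factor `q` in `U' = u³ q(u)`. -/
def derivFactor (s u : ℝ) : ℝ :=
  2 * s ^ 2 + (2 / 3) * s ^ 2 * (4 * s ^ 2 - 3) * u ^ 2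
    + (4 / 3) * s ^ 4 * (8 * s ^ 2 - 5) * u ^ 4
    + (8 / 27) * s ^ 4 * (224 * s ^ 4 - 138 * s ^ 2 + 9) * u ^ 6
    + (8 / 81) * s ^ 6 * (5440 * s ^ 4 - 3504 * s ^ 2 + 423) * u ^ 8

theorem deriv_U19 (s u : ℝ) : deriv (U19 s) u = u ^ 3 * derivFactor s u := by
  have h : ∀ (a : ℝ) (n : ℕ), HasDerivAt (fun u : ℝ => a * u ^ n) (a * (n * u ^ (n - 1))) u :=
    fun a n => (hasDerivAt_pow n u).const_mul a
  refine HasDerivAt.deriv (HasDerivAt.congr_deriv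
    ((((((h (s ^ 2) 4).div_const 2).add (h _ 6)).add (h _ 8)).add (h _ 10)).add (h _ 12)) ?_)
  unfold derivFactor
  push_cast
  ring

theorem U19_strict_local_min {s : ℝ} (hs : s ≠ 0) :
    ∃ δ > 0, ∀ u : ℝ, u ≠ 0 → |u| < δ → U19 s 0 < U19 s u := by
  let p : ℝ → ℝ := fun u => s ^ 2 / 2 + (1 / 9) * s ^ 2 * (4 * s ^ 2 - 3) * u ^ 2
    + (1 / 6) * s ^ 4 * (8 * s ^ 2 - 5) * u ^ 4
    + (4 / 135) * s ^ 4 * (224 * s ^ 4 - 138 * s ^ 2 + 9) * u ^ 6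
    + (2 / 243) * s ^ 6 * (5440 * s ^ 4 - 3504 * s ^ 2 + 423) * u ^ 8
  have hp : Continuous p := by fun_prop
  have hp0 : 0 < p 0 := by
    simp only [p]
    norm_num
    positivity
  obtain ⟨δ, hδ, h⟩ := Metric.eventually_nhds_iff.1 (hp.continuousAt.eventually (lt_mem_nhds hp0))
  refine ⟨δ, hδ, fun u hu huδ => ?_⟩
  have hpu : 0 < p u := h (by simpa [Real.dist_eq] using huδ)
  have hU : U19 s u = u ^ 4 * p u := by
    simp only [U19, p]
    ring
  have hU0 : U19 s 0 = 0 := by simp [U19]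
  rw [hU, hU0]
  positivity

theorem stmt_19 (s : ℝ) (hs : s ≠ 0) :
    (∃ δ > 0, ∀ u : ℝ, u ≠ 0 → |u| < δ → U19 s 0 < U19 s u) ∧
      LocallyAsympStable (fun u => -deriv (U19 s) u) (Set.univ : Set ℝ) 0 := by
  refine ⟨U19_strict_local_min hs, ?_⟩
  simp only [deriv_U19]
  refine locallyAsympStable_neg_cube_mul (q := derivFactor s) ?_ ?_
  · unfold derivFactor
    fun_prop
  · simp only [derivFactor]
    norm_num
    positivity
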